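/- Let n ≥ 2, p ∈ {1,…,n−1} with gcd(n,p) = 1, q ∈ {1,…,n−1} with pq ≡ 1 (mod n), let y be a type (i) coupling from the first interval (p/n − 1/(nq))π < y < pπ/n (so M = pπ − ny > 0), and let b > 0. Let λ ∈ ℂ with ws_b(λ) ≠ 0. Then for every ξ ∈ A_y^+, every θ ∈ ℝ^{n−1}, and all j, ℓ ∈ {1,…,n}: ws_b(x_j − x_ℓ + y) ≠ 0, the elliptic local Lax matrix L^b(ξ,θ|λ)_{j,ℓ} = [ ws_b(y)/ws_b(λ) ] · [ ws_b(x_j − x_ℓ + λ)/ws_b(x_j − x_ℓ + y) ] · v^b_j(ξ,y) · v^b_ℓ(ξ,−y) · ρ(θ)_ℓ is well defined, and Δ_j(θ)⁻¹ · L^b(ξ,θ|λ)_{j,ℓ} · Δ_ℓ(θ) = [ conj(u_j)·u_{σ(ℓ)} / ( |u_j(ξ)|·|u_{σ(ℓ)}(ξ)| ) ] · L^b(ξ,0|λ)_{j,ℓ}, where u = ℰ(ξ,θ) and σ(ℓ) = ℓ+n−p if 1 ≤ ℓ ≤ p, σ(ℓ) = ℓ−p if p < ℓ ≤ n. (This is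 the local-coordinate form of the statement that the elliptic Lax matrix extends smoothly to ℂP^{n−1}.) -/

import Mathlib

open Finset Matrix
open scoped BigOperators Real

noncomputable section

/-- Entries of the `(n-1) × (n-1)` integer matrix `A` (1-based indices):
`A_{j,k} = 1` if `1 ≤ j ≤ n-p` and `j ≤ k < j+p`, `A_{j,k} = -1` if
`n-p < j ≤ n-1` and `j+p-n ≤ k < j`, and `0` otherwise. -/
def Aent (n p : ℕ) (j k : ℕ) : ℤ :=
  if j ≤ n - p ∧ j ≤ k ∧ k < j + p then 1
  else if n - p < j ∧ j + p ≤ k + n ∧ k < j then -1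
  else 0

open Classical in
/-- Entries of the binary matrix `B`: `B_{m,k} = 0` iff `k - m ≡ ℓ p (mod n)`
for some `ℓ ∈ {1, …, n-q}`, else `1`. -/
def Bent (n p q : ℕ) (m k : ℕ) : ℤ :=
  if ∃ ℓ ∈ Finset.Icc 1 (n - q), ((k : ℤ) - (m : ℤ)) ≡ ((ℓ * p : ℕ) : ℤ) [ZMOD (n : ℤ)]
  then 0 else 1

open Classical in
/-- Entries of the binary matrix `C`: `C_{m,k} = 0` iff `k ≡ ℓ p (mod n)`
for some `ℓ ∈ {1, …, n-q}`, else `1`. -/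
def Cent (n p q : ℕ) (m k : ℕ) : ℤ :=
  if ∃ ℓ ∈ Finset.Icc 1 (n - q), ((k : ℤ)) ≡ ((ℓ * p : ℕ) : ℤ) [ZMOD (n : ℤ)]
  then 0 else 1

/-- Entries of `Ω = B - C`. -/
def Ωent (n p q : ℕ) (m k : ℕ) : ℤ := Bent n p q m k - Cent n p q m k

/-- The matrix `A` as an `(n-1) × (n-1)` integer matrix. -/
def Amat (n p : ℕ) : Matrix (Fin (n - 1)) (Fin (n - 1)) ℤ :=
  fun j k => Aent n p (j.1 + 1) (k.1 + 1)

/-- The matrix `Ω = B - C` as an `(n-1) × (n-1)` integer matrix. -/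
def Ωmat (n p q : ℕ) : Matrix (Fin (n - 1)) (Fin (n - 1)) ℤ :=
  fun j k => Ωent n p q (j.1 + 1) (k.1 + 1)

/-- Cyclic window sum `ξ_ℓ + ξ_{ℓ+1} + ⋯ + ξ_{ℓ+d-1}`. -/
def wsum (ξ : ℕ → ℝ) (ℓ d : ℕ) : ℝ := ∑ m ∈ Finset.range d, ξ (ℓ + m)

/-- First type (i) interval: `(p/n - 1/(nq))π < y < pπ/n` (so `M = pπ - ny > 0`). -/
def typeI1 (n p q : ℕ) (y : ℝ) : Prop :=
  ((p : ℝ) / n - 1 / ((n : ℝ) * q)) * Real.pi < y ∧ y < (p : ℝ) * Real.pi / n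

/-- Second type (i) interval: `pπ/n < y < (p/n + 1/(n(n-q)))π` (so `M = pπ - ny < 0`). -/
def typeI2 (n p q : ℕ) (y : ℝ) : Prop :=
  (p : ℝ) * Real.pi / n < y ∧ y < ((p : ℝ) / n + 1 / ((n : ℝ) * ((n : ℝ) - q))) * Real.pi

/-- `M = pπ - ny`. -/
def Mval (n p : ℕ) (y : ℝ) : ℝ := (p : ℝ) * Real.pi - (n : ℝ) * y

/-- Membership of `ξ` (a cyclic sequence of reals, indices `1, …, n`) in the open
domain `A_y^+`: cyclic convention `ξ_{m+n} = ξ_m`, positivity, total sum `π`, and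
`sgn(M)(ξ_j + ⋯ + ξ_{j+p-1} - y) > 0` for `j = 1, …, n`. -/
def inAy (n p : ℕ) (y : ℝ) (ξ : ℕ → ℝ) : Prop :=
  (∀ m, ξ (m + n) = ξ m) ∧
  (∀ k, 1 ≤ k → k ≤ n → 0 < ξ k) ∧
  (∑ k ∈ Finset.Icc 1 n, ξ k = Real.pi) ∧
  (∀ j, 1 ≤ j → j ≤ n → 0 < Real.sign (Mval n p y) * (wsum ξ j p - y))

/-- `|u_j(ξ)|² = sgn(M) (ξ_j + ⋯ + ξ_{j+p-1} - y)`. -/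
def usq (n p : ℕ) (y : ℝ) (ξ : ℕ → ℝ) (j : ℕ) : ℝ :=
  Real.sign (Mval n p y) * (wsum ξ j p - y)

/-- `z_ℓ(ξ, w) = sgn(sin(ny)) ∏_{d=1}^{n-1} sin(ξ_ℓ + ⋯ + ξ_{ℓ+d-1} - w)/sin(ξ_ℓ + ⋯ + ξ_{ℓ+d-1})`;
the paper's `z_ℓ(ξ, ±y)` is obtained at `w = ±y`. -/
def zfun (n : ℕ) (y : ℝ) (ξ : ℕ → ℝ) (w : ℝ) (ℓ : ℕ) : ℝ :=
  Real.sign (Real.sin ((n : ℝ) * y)) *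
    ∏ d ∈ Finset.Icc 1 (n - 1), Real.sin (wsum ξ ℓ d - w) / Real.sin (wsum ξ ℓ d)

/-- `x_j - x_ℓ` expressed through `ξ`: `ξ_ℓ + ⋯ + ξ_{j-1}` for `ℓ ≤ j`, antisymmetric. -/
def xdiff (ξ : ℕ → ℝ) (j ℓ : ℕ) : ℝ :=
  if ℓ ≤ j then wsum ξ ℓ (j - ℓ) else -(wsum ξ j (ℓ - j))

/-- `ρ(θ)_ℓ = exp(i(θ_{ℓ-1} - θ_ℓ))` (with the conventions `θ_0 = θ_n = 0` imposed
as hypotheses on `θ`). -/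
def ρfun (θ : ℕ → ℝ) (ℓ : ℕ) : ℂ :=
  Complex.exp (Complex.I * ((θ (ℓ - 1) - θ ℓ : ℝ) : ℂ))

/-- `Δ_j(θ) = exp(i Σ_{k=1}^{n-1} Ω_{j,k} θ_k)` for `1 ≤ j ≤ n-1`, and `Δ_n(θ) = 1`. -/
def Δfun (n p q : ℕ) (θ : ℕ → ℝ) (j : ℕ) : ℂ :=
  if j = n then 1
  else Complex.exp (Complex.I *
    ((∑ k ∈ Finset.Icc 1 (n - 1), (Ωent n p q j k : ℝ) * θ k : ℝ) : ℂ))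

/-- The local trigonometric Lax matrix
`L(ξ,θ)_{j,ℓ} = [sin y / sin(x_j - x_ℓ + y)] v_j(ξ,y) v_ℓ(ξ,-y) ρ(θ)_ℓ`. -/
def Lloc (n : ℕ) (y : ℝ) (ξ θ : ℕ → ℝ) (j ℓ : ℕ) : ℂ :=
  ((Real.sin y / Real.sin (xdiff ξ j ℓ + y) : ℝ) : ℂ) *
    ((Real.sqrt (zfun n y ξ y j) : ℝ) : ℂ) *
    ((Real.sqrt (zfun n y ξ (-y) ℓ) : ℝ) : ℂ) * ρfun θ ℓ

/-- The embedding map `ℰ(ξ,θ)_j = |u_j(ξ)| Δ_j(θ)^{sgn M}` for `j = 1, …, n-1`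
and `ℰ(ξ,θ)_n = |u_n(ξ)|` (note `Δ_n = 1`). -/
def Emap (n p q : ℕ) (y : ℝ) (ξ θ : ℕ → ℝ) (j : ℕ) : ℂ :=
  ((Real.sqrt (usq n p y ξ j) : ℝ) : ℂ) *
    Δfun n p q θ j ^ (if 0 < Mval n p y then (1 : ℤ) else -1)

/-- `σ(ℓ) = ℓ + n - p` if `1 ≤ ℓ ≤ p`, and `σ(ℓ) = ℓ - p` if `p < ℓ ≤ n`. -/
def σmap (n p : ℕ) (ℓ : ℕ) : ℕ := if ℓ ≤ p then ℓ + n - p else ℓ - p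

/-- The Weierstrass-type function
`ws_b(z) = sin z ∏_{m=1}^∞ (1 + sin² z / sinh²(2 m b))` with `ω = π/2`, `ω' = i b`. -/
def wsb (b : ℝ) (z : ℂ) : ℂ :=
  Complex.sin z *
    ∏' m : ℕ, (1 + Complex.sin z ^ 2 / Complex.sinh (2 * ((m : ℂ) + 1) * (b : ℂ)) ^ 2)

/-- Elliptic analogue of `zfun`, built from `ws_b` instead of `sin`. -/
def zbfun (b : ℝ) (n : ℕ) (y : ℝ) (ξ : ℕ → ℝ) (w : ℝ) (ℓ : ℕ) : ℝ :=
  Real.sign ((wsb b (((n : ℝ) * y : ℝ) : ℂ)).re) *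
    ∏ d ∈ Finset.Icc 1 (n - 1),
      (wsb b ((wsum ξ ℓ d - w : ℝ) : ℂ)).re / (wsb b ((wsum ξ ℓ d : ℝ) : ℂ)).re

/-- The local elliptic Lax matrix with spectral parameter `lam`. -/
def Lbloc (b : ℝ) (n : ℕ) (y : ℝ) (lam : ℂ) (ξ θ : ℕ → ℝ) (j ℓ : ℕ) : ℂ :=
  (wsb b ((y : ℝ) : ℂ) / wsb b lam) *
    (wsb b (((xdiff ξ j ℓ : ℝ) : ℂ) + lam) / wsb b ((xdiff ξ j ℓ + y : ℝ) : ℂ)) *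
    ((Real.sqrt (zbfun b n y ξ y j) : ℝ) : ℂ) *
    ((Real.sqrt (zbfun b n y ξ (-y) ℓ) : ℝ) : ℂ) * ρfun θ ℓ

/-- The subset `S = {ℓ p mod n : ℓ = 1, …, n-q}` of `ℤ/nℤ`. -/
def Sset (n p q : ℕ) : Finset (ZMod n) :=
  (Finset.Icc 1 (n - q)).image (fun ℓ => ((ℓ * p : ℕ) : ZMod n))

/-- The subset `S_i = {i + ℓ mod n : ℓ = 0, …, p-1}` of `ℤ/nℤ`. -/
def Siset (n p : ℕ) (i : ZMod n) : Finset (ZMod n) :=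
  (Finset.range p).image (fun ℓ : ℕ => i + (ℓ : ZMod n))

/-- `I_i = |S_i ∩ S|`. -/
def Inum (n p q : ℕ) (i : ZMod n) : ℕ := (Siset n p i ∩ Sset n p q).card

/-- The function `W_j(ξ)` of Statement 13. -/
def Wfun (n p : ℕ) (y : ℝ) (ξ : ℕ → ℝ) (j : ℕ) : ℝ :=
  (Real.sin (usq n p y ξ j) / usq n p y ξ j) *
    ((-1 : ℝ) ^ (p - 1) / Real.sin (wsum ξ j p)) *
    ∏ d ∈ (Finset.Icc 1 (n - 1)).erase p,
      Real.sin (wsum ξ j d - y) / Real.sin (wsum ξ j d)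

theorem one_le_norm_tprod {f : ℕ → ℂ} (hf : ∀ m, 1 ≤ ‖f m‖) : 1 ≤ ‖∏' m, f m‖ := by
  by_cases h : Multipliable f
  · refine ge_of_tendsto' (Filter.Tendsto.norm h.hasProd) fun s => ?_
    rw [norm_prod]
    simpa using Finset.prod_le_prod (s := s) (fun _ _ => zero_le_one) fun m _ => hf m
  · simp [tprod_eq_one_of_not_multipliable h]

theorem wsb_ofReal_ne_zero (b : ℝ) {x : ℝ} (hx : Real.sin x ≠ 0) : wsb b (x : ℂ) ≠ 0 := by
  refine mul_ne_zero (by exact_mod_cast hx) (norm_pos_iff.mp ?_)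
  refine one_pos.trans_le (one_le_norm_tprod fun m => ?_)
  have h : 1 + Complex.sin (x : ℂ) ^ 2 / Complex.sinh (2 * ((m : ℂ) + 1) * (b : ℂ)) ^ 2 =
      ((1 + Real.sin x ^ 2 / Real.sinh (2 * ((m : ℝ) + 1) * b) ^ 2 : ℝ) : ℂ) := by
    push_cast
    rfl
  rw [h, Complex.norm_real, Real.norm_eq_abs]
  exact le_trans (le_add_of_nonneg_right (by positivity)) (le_abs_self _)

theorem exists_mem_Icc_modEq {n : ℕ} (hn : 1 ≤ n) (k : ℕ) :
    ∃ r, 1 ≤ r ∧ r ≤ n ∧ r ≡ k [MOD n] := by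
  rcases Nat.eq_zero_or_pos (k % n) with h | h
  · exact ⟨n, hn, le_rfl, by simp [Nat.ModEq, h]⟩
  · exact ⟨k % n, h, (Nat.mod_lt _ hn).le, Nat.mod_modEq k n⟩

theorem periodic_eq_of_modEq {n : ℕ} {f : ℕ → ℝ} (hf : ∀ m, f (m + n) = f m) {a c : ℕ}
    (h : a ≡ c [MOD n]) : f a = f c := by
  have hp : Function.Periodic f n := hf
  rw [← hp.map_mod_nat a, ← hp.map_mod_nat c, h]

theorem wsum_add (ξ : ℕ → ℝ) (k a c : ℕ) :
    wsum ξ k (a + c) = wsum ξ k a + wsum ξ (k + a) c := by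
  simp only [wsum, Finset.sum_range_add, add_assoc]

theorem wsum_add_period {n : ℕ} {ξ : ℕ → ℝ} (hξ : ∀ m, ξ (m + n) = ξ m) (k d : ℕ) :
    wsum ξ (k + n) d = wsum ξ k d :=
  Finset.sum_congr rfl fun m _ => by rw [add_right_comm, hξ]

theorem wsum_one (ξ : ℕ → ℝ) (k : ℕ) : wsum ξ k 1 = ξ k := by simp [wsum]

theorem wsum_period {n : ℕ} {ξ : ℕ → ℝ} (hξ : ∀ m, ξ (m + n) = ξ m) (k : ℕ) :
    wsum ξ k n = ∑ i ∈ Finset.Icc 1 n, ξ i := by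
  have step (k : ℕ) : wsum ξ (k + 1) n = wsum ξ k n := by
    have h1 := wsum_add ξ k 1 n
    have h2 := wsum_add ξ k n 1
    rw [add_comm, h2, wsum_one, wsum_one, hξ] at h1
    linarith
  have const (k : ℕ) : wsum ξ k n = wsum ξ 0 n := by
    induction k with
    | zero => rfl
    | succ k ih => rw [step, ih]
  rw [const, ← const 1, wsum, Finset.range_eq_Ico]
  simp only [add_comm 1]
  rw [Finset.sum_Ico_add' ξ 0 n 1]
  rfl

theorem wsum_mul_period {n : ℕ} {ξ : ℕ → ℝ} (hξ : ∀ m, ξ (m + n) = ξ m) (k m : ℕ) :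
    wsum ξ k (n * m) = m * ∑ i ∈ Finset.Icc 1 n, ξ i := by
  induction m with
  | zero => simp [wsum]
  | succ m ih =>
    rw [Nat.mul_succ, wsum_add, ih, wsum_period hξ]
    push_cast
    ring

theorem le_wsum_mul {ξ : ℕ → ℝ} {p : ℕ} {y : ℝ} (h : ∀ k, y ≤ wsum ξ k p) (k m : ℕ) :
    m * y ≤ wsum ξ k (p * m) := by
  induction m with
  | zero => simp [wsum]
  | succ m ih =>
    rw [Nat.mul_succ, wsum_add]
    push_cast
    linarith [h (k + p * m)]

theorem wsum_pos {ξ : ℕ → ℝ} (hξ : ∀ k, 0 < ξ k) (k : ℕ) {d : ℕ} (hd : 0 < d) :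
    0 < wsum ξ k d :=
  Finset.sum_pos (fun _ _ => hξ _) ⟨0, by simpa using hd⟩

theorem wsum_mono {ξ : ℕ → ℝ} (hξ : ∀ k, 0 < ξ k) (k : ℕ) {c d : ℕ} (h : c ≤ d) :
    wsum ξ k c ≤ wsum ξ k d :=
  Finset.sum_le_sum_of_subset_of_nonneg (by simpa using h) fun _ _ _ => (hξ _).le

theorem typeI1_bounds {n p q m : ℕ} (hn : 1 ≤ n) (hpn : p < n) (hq : 1 ≤ q)
    (hm : p * q = 1 + n * m) {y : ℝ} (hy : typeI1 n p q y) :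
    m * Real.pi < q * y ∧ y < Real.pi ∧ 0 < Mval n p y := by
  obtain ⟨h1, h2⟩ := hy
  have hn' : (0 : ℝ) < n := by exact_mod_cast hn
  have hq' : (0 : ℝ) < q := by exact_mod_cast hq
  have hm' : (p : ℝ) * q = 1 + n * m := by exact_mod_cast hm
  have hp' : (p : ℝ) < n := by exact_mod_cast hpn
  refine ⟨?_, ?_, ?_⟩
  · have e : ((p : ℝ) / n - 1 / ((n : ℝ) * q)) * Real.pi = m * Real.pi / q := by
      field_simp
      linarith
    rw [e, div_lt_iff₀ hq'] at h1
    linarith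
  · refine h2.trans ?_
    rw [div_lt_iff₀ hn']
    nlinarith [Real.pi_pos]
  · rw [lt_div_iff₀ hn'] at h2
    rw [Mval]
    linarith

theorem inAy.pos {n p : ℕ} {y : ℝ} {ξ : ℕ → ℝ} (hn : 1 ≤ n) (h : inAy n p y ξ) (k : ℕ) :
    0 < ξ k := by
  obtain ⟨r, h1, h2, h3⟩ := exists_mem_Icc_modEq hn k
  rw [← periodic_eq_of_modEq h.1 h3]
  exact h.2.1 r h1 h2

theorem inAy.lt_wsum {n p : ℕ} {y : ℝ} {ξ : ℕ → ℝ} (hn : 1 ≤ n) (hM : 0 < Mval n p y)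
    (h : inAy n p y ξ) (k : ℕ) : y < wsum ξ k p := by
  obtain ⟨r, h1, h2, h3⟩ := exists_mem_Icc_modEq hn k
  rw [← periodic_eq_of_modEq (f := fun k => wsum ξ k p) (fun m => wsum_add_period h.1 m p) h3]
  have := h.2.2.2 r h1 h2
  rw [Real.sign_of_pos hM, one_mul] at this
  linarith

/-- On `A_y^+` a window of `p - 1` consecutive coordinates has sum less than `y`. -/
theorem inAy.wsum_lt {n p q : ℕ} {y : ℝ} {ξ : ℕ → ℝ} (hn : 1 ≤ n) (hp : 1 ≤ p) (hpn : p < n)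
    (hq : 1 ≤ q) {m : ℕ} (hm : p * q = 1 + n * m) (hy : typeI1 n p q y) (h : inAy n p y ξ)
    (k : ℕ) : wsum ξ (k + 1) (p - 1) < y := by
  obtain ⟨h1, -, h3⟩ := typeI1_bounds hn hpn hq hm hy
  have e1 : wsum ξ k (p * q) = ξ k + m * Real.pi := by
    rw [hm, wsum_add, wsum_one, wsum_mul_period h.1, h.2.2.1]
  have e2 : wsum ξ k (p * q) =
      ξ k + wsum ξ (k + 1) (p - 1) + wsum ξ (k + p) (p * (q - 1)) := by
    conv_lhs => rw [show p * q = (1 + (p - 1)) + p * (q - 1) by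
      obtain ⟨q, rfl⟩ := Nat.exists_eq_add_of_le' hq
      rw [Nat.mul_succ, Nat.add_sub_cancel]
      omega]
    rw [wsum_add, wsum_add, wsum_one, Nat.add_sub_cancel' hp]
  have e3 := le_wsum_mul (fun k => (h.lt_wsum hn h3 k).le) (k + p) (q - 1)
  push_cast [hq] at e3
  linarith

theorem inAy.wsum_ne {n p q : ℕ} {y : ℝ} {ξ : ℕ → ℝ} (hn : 1 ≤ n) (hp : 1 ≤ p) (hpn : p < n)
    (hq : 1 ≤ q) {m : ℕ} (hm : p * q = 1 + n * m) (hy : typeI1 n p q y) (h : inAy n p y ξ)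
    {k : ℕ} (hk : 1 ≤ k) (d : ℕ) : wsum ξ k d ≠ y := by
  obtain ⟨k, rfl⟩ := Nat.exists_eq_add_of_le' hk
  rcases le_or_gt p d with hd | hd
  · have := wsum_mono (h.pos hn) (k + 1) hd
    have := h.lt_wsum hn (typeI1_bounds hn hpn hq hm hy).2.2 (k + 1)
    linarith
  · have := wsum_mono (h.pos hn) (k + 1) (Nat.le_sub_one_of_lt hd)
    have := h.wsum_lt hn hp hpn hq hm hy k
    linarith

theorem inAy.sin_xdiff_add_ne_zero {n p q : ℕ} {y : ℝ} {ξ : ℕ → ℝ} (hn : 1 ≤ n) (hp : 1 ≤ p)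
    (hpn : p < n) (hq : 1 ≤ q) {m : ℕ} (hm : p * q = 1 + n * m) (hy : typeI1 n p q y)
    (h : inAy n p y ξ) {j ℓ : ℕ} (hj : 1 ≤ j) (hjn : j ≤ n) (hℓ : 1 ≤ ℓ) (hℓn : ℓ ≤ n) :
    Real.sin (xdiff ξ j ℓ + y) ≠ 0 := by
  obtain ⟨hy1, hyπ, -⟩ := typeI1_bounds hn hpn hq hm hy
  have hq' : (0 : ℝ) < q := by exact_mod_cast hq
  have hy0 : 0 < y := pos_of_mul_pos_right
    (lt_of_le_of_lt (mul_nonneg m.cast_nonneg Real.pi_pos.le) hy1) hq'.le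
  have hw (k d c : ℕ) (hdc : d + c = n) : wsum ξ k d + wsum ξ (k + d) c = Real.pi := by
    rw [← wsum_add, hdc, wsum_period h.1, h.2.2.1]
  have hne (k d : ℕ) (hk : 1 ≤ k) := h.wsum_ne hn hp hpn hq hm hy hk d
  unfold xdiff
  split_ifs with hjℓ
  · have e := hw ℓ (j - ℓ) (n - (j - ℓ)) (by omega)
    rw [Nat.add_sub_cancel' hjℓ] at e
    have hc := wsum_pos (h.pos hn) j (d := n - (j - ℓ)) (by omega)
    have hd : 0 ≤ wsum ξ ℓ (j - ℓ) := Finset.sum_nonneg fun _ _ => (h.pos hn _).le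
    rcases lt_trichotomy (wsum ξ j (n - (j - ℓ))) y with hlt | heq | hgt
    · rw [← neg_ne_zero, ← Real.sin_sub_pi]
      exact (Real.sin_pos_of_pos_of_lt_pi (by linarith) (by linarith)).ne'
    · exact absurd heq (hne _ _ hj)
    · exact (Real.sin_pos_of_pos_of_lt_pi (by linarith) (by linarith)).ne'
  · have e := hw j (ℓ - j) (n - (ℓ - j)) (by omega)
    have hc := wsum_pos (h.pos hn) (j + (ℓ - j)) (d := n - (ℓ - j)) (by omega)
    have hd := wsum_pos (h.pos hn) j (d := ℓ - j) (by omega)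
    rcases lt_trichotomy (wsum ξ j (ℓ - j)) y with hlt | heq | hgt
    · exact (Real.sin_pos_of_pos_of_lt_pi (by linarith) (by linarith)).ne'
    · exact absurd heq (hne _ _ hj)
    · exact (Real.sin_neg_of_neg_of_neg_pi_lt (by linarith) (by linarith)).ne

open Classical in
theorem ite_exists_eq_sum {n p q : ℕ} (hq1 : 1 ≤ q) (hgcd : Nat.gcd n p = 1) (a : ℤ) :
    (if ∃ t ∈ Finset.Icc 1 (n - q), a ≡ ((t * p : ℕ) : ℤ) [ZMOD (n : ℤ)] then (0 : ℤ) else 1) =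
      1 - ∑ t ∈ Finset.Icc 1 (n - q),
        if a ≡ ((t * p : ℕ) : ℤ) [ZMOD (n : ℤ)] then (1 : ℤ) else 0 := by
  split_ifs with h
  · obtain ⟨t, ht, hta⟩ := h
    rw [Finset.sum_eq_single_of_mem t ht, if_pos hta, sub_self]
    intro s hs hst
    refine if_neg fun hsa => hst ?_
    have h1 : s * p ≡ t * p [MOD n] := Int.natCast_modEq_iff.mp (hsa.symm.trans hta)
    have h2 : s ≡ t [MOD n] := Nat.ModEq.cancel_right_of_coprime hgcd h1
    rw [Finset.mem_Icc] at hs ht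
    exact Nat.ModEq.eq_of_lt_of_lt h2 (by omega) (by omega)
  · push Not at h
    rw [Finset.sum_eq_zero fun t ht => if_neg (h t ht), sub_zero]

theorem σmap_modEq {n p ℓ : ℕ} (hpn : p ≤ n) (hℓ : 1 ≤ ℓ) :
    (σmap n p ℓ : ℤ) ≡ (ℓ : ℤ) - p [ZMOD (n : ℤ)] := by
  unfold σmap
  split_ifs with h
  · rw [Nat.cast_sub (by omega), Nat.cast_add]
    exact (Int.modEq_iff_dvd.mpr ⟨-1, by ring⟩)
  · rw [Nat.cast_sub (by omega)]

open Classical in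
theorem Bent_sub_Bent_σmap {n p q ℓ : ℕ} (hpn : p ≤ n) (hq1 : 1 ≤ q) (hqn : q ≤ n)
    (hgcd : Nat.gcd n p = 1) (hpq : p * q ≡ 1 [MOD n]) (hℓ : 1 ≤ ℓ) (k : ℕ) :
    Bent n p q ℓ k - Bent n p q (σmap n p ℓ) k =
      (if (k : ℤ) - ℓ ≡ 0 [ZMOD (n : ℤ)] then 1 else 0) -
        (if (k : ℤ) - ℓ ≡ -1 [ZMOD (n : ℤ)] then 1 else 0) := by
  have hσ := σmap_modEq hpn hℓ (n := n)
  have hshift (t : ℕ) : ((k : ℤ) - σmap n p ℓ ≡ (((t + 1) * p : ℕ) : ℤ) [ZMOD (n : ℤ)]) ↔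
      ((k : ℤ) - ℓ ≡ ((t * p : ℕ) : ℤ) [ZMOD (n : ℤ)]) := by
    rw [Int.modEq_iff_dvd] at hσ
    rw [Int.modEq_iff_dvd, Int.modEq_iff_dvd, ← dvd_add_left hσ]
    apply iff_of_eq
    congr 1
    push_cast
    ring
  have hlast : (((n - q) * p : ℕ) : ℤ) ≡ -1 [ZMOD (n : ℤ)] := by
    have h := Int.modEq_iff_dvd.mp (Int.natCast_modEq_iff.mpr hpq)
    rw [Int.modEq_iff_dvd]
    obtain ⟨c, hc⟩ := h
    refine ⟨-c - p, ?_⟩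
    push_cast [hqn] at hc ⊢
    linear_combination -hc
  have hB (m : ℕ) := ite_exists_eq_sum hq1 hgcd ((k : ℤ) - m)
  unfold Bent
  rw [hB, hB]
  set g : ℕ → ℤ := fun t => if (k : ℤ) - ℓ ≡ ((t * p : ℕ) : ℤ) [ZMOD (n : ℤ)] then 1 else 0
    with hg
  have e1 : ∑ t ∈ Finset.Icc 1 (n - q),
      (if (k : ℤ) - ℓ ≡ ((t * p : ℕ) : ℤ) [ZMOD (n : ℤ)] then (1 : ℤ) else 0) =
      ∑ t ∈ Finset.range (n - q), g (t + 1) := by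
    rw [Finset.range_eq_Ico, Finset.sum_Ico_add' g 0 (n - q) 1]
    rfl
  have e2 : ∑ t ∈ Finset.Icc 1 (n - q),
      (if (k : ℤ) - σmap n p ℓ ≡ ((t * p : ℕ) : ℤ) [ZMOD (n : ℤ)] then (1 : ℤ) else 0) =
      ∑ t ∈ Finset.range (n - q), g t := by
    rw [Finset.range_eq_Ico, hg]
    simp only [← hshift]
    rw [Finset.sum_Ico_add' (fun t : ℕ => if (k : ℤ) - σmap n p ℓ ≡ ((t * p : ℕ) : ℤ)
      [ZMOD (n : ℤ)] then (1 : ℤ) else 0) 0 (n - q) 1]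
    rfl
  have e3 := Finset.sum_range_sub g (n - q)
  rw [Finset.sum_sub_distrib] at e3
  have e4 : g (n - q) = if (k : ℤ) - ℓ ≡ -1 [ZMOD (n : ℤ)] then 1 else 0 :=
    if_congr ⟨fun h => h.trans hlast, fun h => h.trans hlast.symm⟩ rfl rfl
  have e5 : g 0 = if (k : ℤ) - ℓ ≡ 0 [ZMOD (n : ℤ)] then 1 else 0 := by simp [hg]
  rw [e1, e2, ← e4, ← e5]
  linarith

theorem Ωent_self (n p q k : ℕ) : Ωent n p q n k = 0 := by
  have h (a : ℤ) : (k : ℤ) - n ≡ a [ZMOD (n : ℤ)] ↔ (k : ℤ) ≡ a [ZMOD (n : ℤ)] := by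
    have e : (k : ℤ) - n ≡ k [ZMOD (n : ℤ)] := Int.modEq_iff_dvd.mpr ⟨1, by ring⟩
    exact ⟨fun h => e.symm.trans h, fun h => e.trans h⟩
  simp only [Ωent, Bent, Cent, h, sub_self]

theorem Δfun_eq_exp (n p q : ℕ) (θ : ℕ → ℝ) (j : ℕ) :
    Δfun n p q θ j = Complex.exp (Complex.I *
      ((∑ k ∈ Finset.Icc 1 (n - 1), (Ωent n p q j k : ℝ) * θ k : ℝ) : ℂ)) := by
  unfold Δfun
  split_ifs with h
  · simp [h, Ωent_self]
  · rfl

theorem sum_Ωent_sub {n p q ℓ : ℕ} (hpn : p ≤ n) (hq1 : 1 ≤ q) (hqn : q ≤ n)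
    (hgcd : Nat.gcd n p = 1) (hpq : p * q ≡ 1 [MOD n]) (hℓ : 1 ≤ ℓ) (hℓn : ℓ ≤ n)
    {θ : ℕ → ℝ} (hθ0 : θ 0 = 0) (hθn : θ n = 0) :
    ∑ k ∈ Finset.Icc 1 (n - 1), (Ωent n p q ℓ k : ℝ) * θ k -
      ∑ k ∈ Finset.Icc 1 (n - 1), (Ωent n p q (σmap n p ℓ) k : ℝ) * θ k =
      θ ℓ - θ (ℓ - 1) := by
  classical
  have key (k : ℕ) (hk : k ∈ Finset.Icc 1 (n - 1)) :
      (Ωent n p q ℓ k : ℝ) * θ k - (Ωent n p q (σmap n p ℓ) k : ℝ) * θ k =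
        (if k = ℓ then θ k else 0) - (if k = ℓ - 1 then θ k else 0) := by
    rw [Finset.mem_Icc] at hk
    have i1 : (k : ℤ) - ℓ ≡ 0 [ZMOD (n : ℤ)] ↔ k = ℓ := by
      constructor
      · intro h
        have := Int.eq_zero_of_abs_lt_dvd (Int.modEq_zero_iff_dvd.mp h)
          (by rw [abs_lt]; constructor <;> omega)
        omega
      · rintro rfl
        rw [sub_self]
    have i2 : (k : ℤ) - ℓ ≡ -1 [ZMOD (n : ℤ)] ↔ k = ℓ - 1 := by
      constructor
      · intro h
        have := Int.eq_zero_of_abs_lt_dvd (Int.modEq_iff_dvd.mp h)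
          (by rw [abs_lt]; constructor <;> omega)
        omega
      · rintro rfl
        rw [Nat.cast_sub hℓ]
        simp [Int.ModEq]
    have hB := Bent_sub_Bent_σmap hpn hq1 hqn hgcd hpq hℓ k
    simp only [i1, i2] at hB
    have hB' : (Bent n p q ℓ k : ℝ) - Bent n p q (σmap n p ℓ) k =
        (if k = ℓ then 1 else 0) - (if k = ℓ - 1 then 1 else 0) := by
      exact_mod_cast hB
    have hC : Cent n p q (σmap n p ℓ) k = Cent n p q ℓ k := rfl
    rw [← sub_mul, Ωent, Ωent, hC]
    push_cast
    rw [sub_sub_sub_cancel_right, hB', sub_mul]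
    simp
  rw [← Finset.sum_sub_distrib, Finset.sum_congr rfl key, Finset.sum_sub_distrib,
    Finset.sum_ite_eq', Finset.sum_ite_eq']
  congr 1
  · rw [ite_eq_left_iff, Finset.mem_Icc]
    intro h
    rw [show ℓ = n by omega, hθn]
  · rw [ite_eq_left_iff, Finset.mem_Icc]
    intro h
    rw [show ℓ - 1 = 0 by omega, hθ0]

theorem Δfun_mul_ρfun {n p q ℓ : ℕ} (hpn : p ≤ n) (hq1 : 1 ≤ q) (hqn : q ≤ n)
    (hgcd : Nat.gcd n p = 1) (hpq : p * q ≡ 1 [MOD n]) (hℓ : 1 ≤ ℓ) (hℓn : ℓ ≤ n)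
    {θ : ℕ → ℝ} (hθ0 : θ 0 = 0) (hθn : θ n = 0) :
    Δfun n p q θ ℓ * ρfun θ ℓ = Δfun n p q θ (σmap n p ℓ) := by
  have h := sum_Ωent_sub hpn hq1 hqn hgcd hpq hℓ hℓn hθ0 hθn
  rw [Δfun_eq_exp, Δfun_eq_exp, ρfun, ← Complex.exp_add, ← mul_add, ← Complex.ofReal_add]
  congr 3
  linarith

theorem conj_Δfun (n p q : ℕ) (θ : ℕ → ℝ) (j : ℕ) :
    starRingEnd ℂ (Δfun n p q θ j) = (Δfun n p q θ j)⁻¹ := by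
  rw [Δfun_eq_exp, ← Complex.exp_conj, ← Complex.exp_neg, map_mul, Complex.conj_I,
    Complex.conj_ofReal, neg_mul]

/-- Elliptic version of Statement 6 (first type (i) interval, `M > 0`):
`ws_b(x_j - x_ℓ + y) ≠ 0`, so the elliptic local Lax matrix is well defined, and
`Δ_j(θ)⁻¹ L^b(ξ,θ|λ)_{j,ℓ} Δ_ℓ(θ) = [conj(u_j) u_{σ(ℓ)} / (|u_j(ξ)| |u_{σ(ℓ)}(ξ)|)] · L^b(ξ,0|λ)_{j,ℓ}`. -/
theorem stmt18 (n p q : ℕ) (hn : 2 ≤ n) (hp1 : 1 ≤ p) (hpn : p ≤ n - 1)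
    (hgcd : Nat.gcd n p = 1) (hq1 : 1 ≤ q) (hqn : q ≤ n - 1)
    (hpq : p * q ≡ 1 [MOD n])
    (b : ℝ) (hb : 0 < b)
    (y : ℝ) (hy : typeI1 n p q y)
    (lam : ℂ) (hlam : wsb b lam ≠ 0)
    (ξ : ℕ → ℝ) (hξ : inAy n p y ξ)
    (θ : ℕ → ℝ) (hθ0 : θ 0 = 0) (hθn : θ n = 0)
    (j ℓ : ℕ) (hj1 : 1 ≤ j) (hjn : j ≤ n) (hℓ1 : 1 ≤ ℓ) (hℓn : ℓ ≤ n) :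
    wsb b ((xdiff ξ j ℓ + y : ℝ) : ℂ) ≠ 0 ∧
    (Δfun n p q θ j)⁻¹ * Lbloc b n y lam ξ θ j ℓ * Δfun n p q θ ℓ =
      (starRingEnd ℂ (Emap n p q y ξ θ j) * Emap n p q y ξ θ (σmap n p ℓ)) /
        (((Real.sqrt (usq n p y ξ j) * Real.sqrt (usq n p y ξ (σmap n p ℓ)) : ℝ)) : ℂ) *
        Lbloc b n y lam ξ (fun _ => 0) j ℓ := by
  obtain ⟨m, hm⟩ : ∃ m, p * q = 1 + n * m := by
    obtain ⟨m, hm⟩ := (Nat.modEq_iff_dvd' (Nat.mul_pos hp1 hq1)).mp hpq.symm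
    exact ⟨m, by have := Nat.mul_pos hp1 hq1; omega⟩
  have hn1 : 1 ≤ n := by omega
  have hpn' : p < n := by omega
  have hM := (typeI1_bounds hn1 hpn' hq1 hm hy).2.2
  refine ⟨wsb_ofReal_ne_zero b
    (hξ.sin_xdiff_add_ne_zero hn1 hp1 hpn' hq1 hm hy hj1 hjn hℓ1 hℓn), ?_⟩
  have hu (k : ℕ) : ((Real.sqrt (usq n p y ξ k) : ℝ) : ℂ) ≠ 0 := by
    rw [Complex.ofReal_ne_zero, Real.sqrt_ne_zero', usq, Real.sign_of_pos hM, one_mul, sub_pos]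
    exact hξ.lt_wsum hn1 hM k
  have hE (k : ℕ) : Emap n p q y ξ θ k =
      ((Real.sqrt (usq n p y ξ k) : ℝ) : ℂ) * Δfun n p q θ k := by
    rw [Emap, if_pos hM, zpow_one]
  have hL : Lbloc b n y lam ξ θ j ℓ = Lbloc b n y lam ξ (fun _ => 0) j ℓ * ρfun θ ℓ := by
    simp [Lbloc, ρfun]
  have hΔ := Δfun_mul_ρfun (θ := θ) hpn'.le hq1 (by omega : q ≤ n) hgcd hpq hℓ1 hℓn hθ0 hθn
  have hj := hu j
  have hσ := hu (σmap n p ℓ)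
  rw [hE, hE, hL, ← hΔ, map_mul, conj_Δfun, Complex.conj_ofReal, Complex.ofReal_mul]
  generalize Δfun n p q θ j = D
  field_simp

end
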